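/- arXiv:1406.0423 — 7 statements merged into one kernel-verified Lean document; each statement's English description precedes it below -/
import Mathlib

section
/- Let (Ω, 𝔉, μ) be a measure space, p : Ω → [0,∞) measurable with ∫ p dμ = 1, and D : Ω → ℝ measurable with ∫ |D| p dμ < ∞ and ∫ D p dμ = 0, and suppose there exists δ > 0 with ∫ exp(ε D) p dμ < ∞ for all |ε| < δ. Let o₁, …, o_n ∈ Ω. If ε = 0 is a local maximum of the log-likelihood ε ↦ Σ_{i=1}^n [ε D(o_i) − Λ(ε)] on (−δ, δ), where Λ(ε) = log ∫ exp(ε D(o)) p(o) dμ(o), then Σ_{i=1}^n D(o_i) = 0; that is, the density at which the TMLE update step returns ε̂ = 0 solves the efficient influence function estimating equation. -/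
open MeasureTheory Real

/-- If `exp (ε D) p` is integrable for all `|ε| < δ`, then `ε ↦ ∫ exp (ε D) p dμ` has derivative
`∫ D p dμ` at `0`. -/
theorem hasDerivAt_integral_exp_mul_density_zero
    {Ω : Type*} [MeasurableSpace Ω] {μ : Measure Ω}
    {p : Ω → ℝ} (hp_meas : Measurable p) (hp_nonneg : ∀ o, 0 ≤ p o) {D : Ω → ℝ}
    {δ : ℝ} (hδ : 0 < δ)
    (hexp : ∀ ε : ℝ, |ε| < δ → Integrable (fun o => Real.exp (ε * D o) * p o) μ) :
    HasDerivAt (fun ε : ℝ => ∫ o, Real.exp (ε * D o) * p o ∂μ) (∫ o, D o * p o ∂μ) 0 := by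
  set ν : Measure Ω := μ.withDensity fun o => ((p o).toNNReal : ENNReal) with hν
  have hq : Measurable fun o => (p o).toNNReal := hp_meas.real_toNNReal
  have hsmul (f : Ω → ℝ) : (fun o => (p o).toNNReal • f o) = fun o => f o * p o := by
    ext o
    rw [NNReal.smul_def, Real.coe_toNNReal _ (hp_nonneg o), smul_eq_mul, mul_comm]
  have hint (f : Ω → ℝ) : ∫ o, f o ∂ν = ∫ o, f o * p o ∂μ := by
    rw [hν, integral_withDensity_eq_integral_smul hq, hsmul]
  have hmem : (0 : ℝ) ∈ interior (ProbabilityTheory.integrableExpSet D ν) := by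
    refine mem_interior.mpr ⟨Set.Ioo (-δ) δ, fun ε hε => ?_, isOpen_Ioo, by simp [hδ]⟩
    change Integrable (fun o => Real.exp (ε * D o)) ν
    rw [hν, integrable_withDensity_iff_integrable_smul hq, hsmul]
    exact hexp ε (abs_lt.mpr hε)
  have hderiv := ProbabilityTheory.hasDerivAt_mgf hmem
  simp only [zero_mul, Real.exp_zero, mul_one, hint] at hderiv
  refine hderiv.congr_of_eventuallyEq (Filter.Eventually.of_forall fun ε => ?_)
  exact (hint _).symm

/-- If `ε = 0` is a maximizer on `(−δ, δ)` of the exponential-tilt log-likelihood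
`ε ↦ Σᵢ [ε D(oᵢ) − Λ(ε)]`, where `Λ(ε) = log ∫ exp(ε D) p dμ` and `∫ D p dμ = 0`,
then `Σᵢ D(oᵢ) = 0`: the density at which the TMLE update returns `ε̂ = 0` solves the
efficient influence function estimating equation. -/
theorem tmle_fixed_point_solves_eif_equation
    {Ω : Type*} [MeasurableSpace Ω] (μ : Measure Ω)
    (p : Ω → ℝ) (hp_meas : Measurable p) (hp_nonneg : ∀ o, 0 ≤ p o)
    (hp_int : ∫ o, p o ∂μ = 1)
    (D : Ω → ℝ) (hD_meas : Measurable D)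
    (hDp_int : Integrable (fun o => |D o| * p o) μ)
    (hDp_zero : ∫ o, D o * p o ∂μ = 0)
    (δ : ℝ) (hδ : 0 < δ)
    (hexp : ∀ ε : ℝ, |ε| < δ → Integrable (fun o => Real.exp (ε * D o) * p o) μ)
    (n : ℕ) (obs : Fin n → Ω)
    (hmax : IsMaxOn
      (fun ε : ℝ => ∑ i, (ε * D (obs i) - Real.log (∫ o, Real.exp (ε * D o) * p o ∂μ)))
      (Set.Ioo (-δ) δ) 0) :
    ∑ i, D (obs i) = 0 := by
  have hZ := hasDerivAt_integral_exp_mul_density_zero hp_meas hp_nonneg hδ hexp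
  rw [hDp_zero] at hZ
  have hΛ := hZ.log (by simp [hp_int])
  rw [zero_div] at hΛ
  have hL : HasDerivAt
      (fun ε : ℝ => ∑ i, (ε * D (obs i) - Real.log (∫ o, Real.exp (ε * D o) * p o ∂μ)))
      (∑ i, D (obs i)) 0 := by
    refine HasDerivAt.fun_sum fun i _ => ?_
    simpa using ((hasDerivAt_id (0 : ℝ)).mul_const (D (obs i))).fun_sub hΛ
  exact (hmax.isLocalMax (Ioo_mem_nhds (neg_lt_zero.mpr hδ) hδ)).hasDerivAt_eq_zero hL
end

section
/- Let σ(x) = 1/(1 + e^{−x}) be the logistic (expit) function. Let (Ω, 𝔉, μ) be a measure space, p : Ω → [0,∞) measurable with ∫ p dμ = 1, and D : Ω → ℝ measurable with ∫ |D| p dμ < ∞ and ∫ D p dμ = 0. Define the submodel q_ε(o) = σ(2 ε D(o)) p(o) / C(ε), where C(ε) = ∫ σ(2 ε D(o)) p(o) dμ(o). Then q_0 = p, and for every o ∈ Ω the derivative at ε = 0 of ε ↦ log σ(2 ε D(o)) − log C(ε) equals D(o); that is, the score of this submodel at ε = 0 equals D(o). -/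
open MeasureTheory Real

/-- The derivative in `ε` of the logistic perturbation `σ(2 ε d)`. -/
theorem hasDerivAt_sigmoid_two_mul_mul (d ε : ℝ) :
    HasDerivAt (fun ε : ℝ => sigmoid (2 * ε * d))
      (sigmoid (2 * ε * d) * (1 - sigmoid (2 * ε * d)) * (2 * d)) ε := by
  have h : HasDerivAt (fun ε : ℝ => 2 * ε * d) (2 * d) ε := by
    simpa using ((hasDerivAt_id ε).const_mul 2).mul_const d
  exact HasDerivAt.comp (h₂ := sigmoid) ε (hasDerivAt_sigmoid (2 * ε * d)) h

/-- The normalizing constant of the logistic submodel is differentiable at `0`, and the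
derivative is half of the mean of `D`. -/
theorem hasDerivAt_integral_sigmoid_two_mul_mul {Ω : Type*} [MeasurableSpace Ω] {μ : Measure Ω}
    {p D : Ω → ℝ} (hp : Integrable p μ) (hD : Measurable D)
    (hDp : Integrable (fun o => D o * p o) μ) :
    HasDerivAt (fun ε : ℝ => ∫ o, sigmoid (2 * ε * D o) * p o ∂μ)
      (2⁻¹ * ∫ o, D o * p o ∂μ) 0 := by
  have h_meas (ε : ℝ) : AEStronglyMeasurable (fun o => sigmoid (2 * ε * D o) * p o) μ :=
    ((continuous_sigmoid.measurable.comp (hD.const_mul (2 * ε))).aestronglyMeasurable).mul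
      hp.aestronglyMeasurable
  have key := hasDerivAt_integral_of_dominated_loc_of_deriv_le (μ := μ) (𝕜 := ℝ)
    (F := fun ε o => sigmoid (2 * ε * D o) * p o)
    (F' := fun ε o =>
      sigmoid (2 * ε * D o) * (1 - sigmoid (2 * ε * D o)) * (2 * D o) * p o)
    (bound := fun o => 2 * ‖D o * p o‖) (x₀ := (0 : ℝ)) (s := Set.univ)
    Filter.univ_mem (Filter.Eventually.of_forall h_meas)
    (by simpa using hp.const_mul 2⁻¹)
    (by
      refine (hDp.const_mul 2⁻¹).aestronglyMeasurable.congr (Filter.Eventually.of_forall ?_)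
      intro o
      simp only [mul_zero, zero_mul, sigmoid_zero]
      ring)
    (by
      refine Filter.Eventually.of_forall fun o ε _ => ?_
      have h0 := sigmoid_pos (2 * ε * D o)
      have h1 := sigmoid_lt_one (2 * ε * D o)
      have hs : |sigmoid (2 * ε * D o) * (1 - sigmoid (2 * ε * D o))| ≤ 1 := by
        rw [abs_le]
        constructor <;> nlinarith
      calc ‖sigmoid (2 * ε * D o) * (1 - sigmoid (2 * ε * D o)) * (2 * D o) * p o‖
          = |sigmoid (2 * ε * D o) * (1 - sigmoid (2 * ε * D o))| * (2 * ‖D o * p o‖) := by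
            simp only [Real.norm_eq_abs, abs_mul, abs_two]
            ring
        _ ≤ 1 * (2 * ‖D o * p o‖) := by gcongr
        _ = 2 * ‖D o * p o‖ := one_mul _)
    (hDp.norm.const_mul 2)
    (Filter.Eventually.of_forall fun o ε _ =>
      (hasDerivAt_sigmoid_two_mul_mul (D o) ε).mul_const (p o))
  refine key.2.congr_deriv ?_
  rw [← integral_const_mul]
  congr 1 with o
  simp only [mul_zero, zero_mul, sigmoid_zero]
  ring

/-- For the logistic-type submodel `q_ε(o) = σ(2 ε D(o)) p(o) / C(ε)`, with
`σ(x) = 1/(1 + e^{−x})` and `C(ε) = ∫ σ(2 ε D(o)) p(o) dμ(o)`: at `ε = 0` the submodel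
equals `p`, and the score at `ε = 0` equals `D(o)` for every `o`. -/
theorem logistic_submodel_valid
    {Ω : Type*} [MeasurableSpace Ω] (μ : Measure Ω)
    (σ : ℝ → ℝ) (hσ : ∀ x, σ x = 1 / (1 + Real.exp (-x)))
    (p : Ω → ℝ) (hp_meas : Measurable p) (hp_nonneg : ∀ o, 0 ≤ p o)
    (hp_int : ∫ o, p o ∂μ = 1)
    (D : Ω → ℝ) (hD_meas : Measurable D)
    (hDp_int : Integrable (fun o => |D o| * p o) μ)
    (hDp_zero : ∫ o, D o * p o ∂μ = 0)
    (C : ℝ → ℝ) (hC : ∀ ε, C ε = ∫ o, σ (2 * ε * D o) * p o ∂μ) :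
    (∀ o : Ω, σ (2 * 0 * D o) * p o / C 0 = p o) ∧
    ∀ o : Ω, HasDerivAt (fun ε : ℝ => Real.log (σ (2 * ε * D o)) - Real.log (C ε))
      (D o) 0 := by
  obtain rfl : σ = sigmoid := by
    ext x
    rw [hσ, sigmoid_def, one_div]
  obtain rfl : C = fun ε => ∫ o, sigmoid (2 * ε * D o) * p o ∂μ := funext hC
  have hp : Integrable p μ := by
    by_contra h
    simp [integral_undef h] at hp_int
  have hDp : Integrable (fun o => D o * p o) μ := by
    refine hDp_int.mono (hD_meas.mul hp_meas).aestronglyMeasurable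
      (Filter.Eventually.of_forall fun o => ?_)
    simp
  have hC0 : ∫ o, sigmoid (2 * 0 * D o) * p o ∂μ = 2⁻¹ := by
    simp [sigmoid_zero, integral_const_mul, hp_int]
  refine ⟨fun o => ?_, fun o => ?_⟩
  · simp only [hC0]
    simp only [mul_zero, zero_mul, sigmoid_zero]
    ring
  · have hC' := hasDerivAt_integral_sigmoid_two_mul_mul hp hD_meas hDp
    rw [hDp_zero, mul_zero] at hC'
    have hlogC := hC'.log (by rw [hC0]; norm_num)
    have hlogσ := (hasDerivAt_sigmoid_two_mul_mul (D o) 0).log (sigmoid_pos _).ne'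
    refine (hlogσ.sub hlogC).congr_deriv ?_
    simp only [mul_zero, zero_mul, sigmoid_zero]
    ring
end

section
/- Let (X, Y) be a random vector with Y integrable, let g : 𝒳 × ℝ^d → ℝ be measurable with E|g(X, β)| < ∞ for all β, and suppose the median regression model is correctly specified at β₀, i.e., P(Y ≥ g(X, β₀) | X) ≥ 1/2 and P(Y ≤ g(X, β₀) | X) ≥ 1/2 almost surely. Then for every β ∈ ℝ^d, E|Y − g(X, β₀)| ≤ E|Y − g(X, β)|. Consequently, if β ↦ E|Y − g(X, β)| has a unique minimizer β*, then β* = β₀; that is, the nonparametric extension β*(p) = argmin_β E_p|Y − g(X, β)| of the median regression parameter equals the true regression parameter when the model is correctly specified. -/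
open MeasureTheory Real

/-- If `h` has conditional mean at least `c` given `m`, then weighting by a nonnegative
`m`-measurable function preserves the bound in mean. -/
theorem const_mul_integral_le_integral_mul_of_le_condExp {Ω : Type*} {m mΩ : MeasurableSpace Ω}
    {μ : Measure Ω} [IsFiniteMeasure μ] (hm : m ≤ mΩ) {f h : Ω → ℝ} {c : ℝ}
    (hf : StronglyMeasurable[m] f) (hf_nonneg : 0 ≤ f) (hf_int : Integrable f μ)
    (hh : Integrable h μ) (hfh : Integrable (fun ω => f ω * h ω) μ)
    (hc : ∀ᵐ ω ∂μ, c ≤ (μ[h|m]) ω) :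
    c * ∫ ω, f ω ∂μ ≤ ∫ ω, f ω * h ω ∂μ := by
  have hpull : μ[fun ω => f ω * h ω|m] =ᵐ[μ] fun ω => f ω * (μ[h|m]) ω :=
    condExp_mul_of_stronglyMeasurable_left hf hfh hh
  rw [← integral_condExp hm (f := fun ω => f ω * h ω), ← integral_const_mul]
  refine integral_mono_ae (hf_int.const_mul c) integrable_condExp ?_
  filter_upwards [hpull, hc] with ω hω hcω
  rw [hω, mul_comm]
  exact mul_le_mul_of_nonneg_left hcω (hf_nonneg ω)

/-- A subgradient inequality for `t ↦ |y - t|` at `a`. -/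
theorem abs_sub_add_le_abs_sub (y a b : ℝ) :
    |y - a| + (max (b - a) 0 * (2 * (if y ≤ a then (1 : ℝ) else 0) - 1) +
      max (a - b) 0 * (2 * (if a ≤ y then (1 : ℝ) else 0) - 1)) ≤ |y - b| := by
  rcases abs_cases (y - a) with h | h <;> rcases abs_cases (y - b) with h' | h' <;>
    rcases max_cases (b - a) 0 with h₁ | h₁ <;> rcases max_cases (a - b) 0 with h₂ | h₂ <;>
    split_ifs <;> rw [h.1, h'.1, h₁.1, h₂.1] <;> linarith

/-- If the median regression model is correctly specified at `β₀`, i.e.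
`P(Y ≥ g(X, β₀) | X) ≥ 1/2` and `P(Y ≤ g(X, β₀) | X) ≥ 1/2` a.s., then
`E|Y − g(X, β₀)| ≤ E|Y − g(X, β)|` for every `β`; consequently, if
`β ↦ E|Y − g(X, β)|` has a unique minimizer `β*`, then `β* = β₀`. -/
theorem correctly_specified_median_regression_minimizer
    {Ω 𝒳 : Type*} [mΩ : MeasurableSpace Ω] [MeasurableSpace 𝒳] {d : ℕ}
    {μ : Measure Ω} [IsProbabilityMeasure μ]
    (X : Ω → 𝒳) (hX : Measurable X)
    (Y : Ω → ℝ) (hY : Measurable Y) (hY_int : Integrable Y μ)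
    (g : 𝒳 → EuclideanSpace ℝ (Fin d) → ℝ)
    (hg_meas : ∀ β, Measurable (fun x => g x β))
    (hg_int : ∀ β, Integrable (fun ω => |g (X ω) β|) μ)
    (β₀ : EuclideanSpace ℝ (Fin d))
    (hge : ∀ᵐ ω ∂μ, (1 : ℝ) / 2 ≤
      (μ[fun ω' => if g (X ω') β₀ ≤ Y ω' then (1 : ℝ) else 0|MeasurableSpace.comap X ‹MeasurableSpace 𝒳›]) ω)
    (hle : ∀ᵐ ω ∂μ, (1 : ℝ) / 2 ≤
      (μ[fun ω' => if Y ω' ≤ g (X ω') β₀ then (1 : ℝ) else 0|MeasurableSpace.comap X ‹MeasurableSpace 𝒳›]) ω) :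
    (∀ β : EuclideanSpace ℝ (Fin d),
      ∫ ω, |Y ω - g (X ω) β₀| ∂μ ≤ ∫ ω, |Y ω - g (X ω) β| ∂μ) ∧
    (∀ βstar : EuclideanSpace ℝ (Fin d),
      (∀ β : EuclideanSpace ℝ (Fin d), β ≠ βstar →
        ∫ ω, |Y ω - g (X ω) βstar| ∂μ < ∫ ω, |Y ω - g (X ω) β| ∂μ) →
      βstar = β₀) := by
  have hmin : ∀ β : EuclideanSpace ℝ (Fin d),
      ∫ ω, |Y ω - g (X ω) β₀| ∂μ ≤ ∫ ω, |Y ω - g (X ω) β| ∂μ := by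
    intro β
    have hgi : ∀ β, Integrable (fun ω => g (X ω) β) μ := fun β =>
      (integrable_norm_iff ((hg_meas β).comp hX).aestronglyMeasurable).1 (hg_int β)
    have hweight : ∀ (β₁ β₂ : EuclideanSpace ℝ (Fin d)) (s : Set Ω) [DecidablePred (· ∈ s)],
        MeasurableSet s →
        (∀ᵐ ω ∂μ, (1 : ℝ) / 2 ≤ (μ[fun ω' => if ω' ∈ s then (1 : ℝ) else 0|
          MeasurableSpace.comap X ‹MeasurableSpace 𝒳›]) ω) →
        Integrable (fun ω => max (g (X ω) β₁ - g (X ω) β₂) 0 *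
          (2 * (if ω ∈ s then (1 : ℝ) else 0) - 1)) μ ∧
        0 ≤ ∫ ω, max (g (X ω) β₁ - g (X ω) β₂) 0 *
          (2 * (if ω ∈ s then (1 : ℝ) else 0) - 1) ∂μ := by
      intro β₁ β₂ s _ hs hc
      have hf_int : Integrable (fun ω => max (g (X ω) β₁ - g (X ω) β₂) 0) μ :=
        ((hgi β₁).sub (hgi β₂)).pos_part
      have hf : StronglyMeasurable[MeasurableSpace.comap X ‹MeasurableSpace 𝒳›]
          (fun ω => max (g (X ω) β₁ - g (X ω) β₂) 0) :=
        ((((hg_meas β₁).sub (hg_meas β₂)).max measurable_const).comp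
          (comap_measurable X)).stronglyMeasurable
      have hind : Measurable (fun ω => if ω ∈ s then (1 : ℝ) else 0) :=
        Measurable.ite hs measurable_const measurable_const
      have hbound : ∀ᵐ ω ∂μ, ‖(if ω ∈ s then (1 : ℝ) else 0)‖ ≤ 1 :=
        Filter.Eventually.of_forall fun ω => by split_ifs <;> simp
      have hfh : Integrable (fun ω => max (g (X ω) β₁ - g (X ω) β₂) 0 *
          (if ω ∈ s then (1 : ℝ) else 0)) μ :=
        hf_int.mul_bdd hind.aestronglyMeasurable hbound
      have hsplit : (fun ω => max (g (X ω) β₁ - g (X ω) β₂) 0 *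
          (2 * (if ω ∈ s then (1 : ℝ) else 0) - 1)) =
          fun ω => 2 * (max (g (X ω) β₁ - g (X ω) β₂) 0 * (if ω ∈ s then (1 : ℝ) else 0)) -
            max (g (X ω) β₁ - g (X ω) β₂) 0 := by
        funext ω
        ring
      rw [hsplit]
      refine ⟨(hfh.const_mul 2).sub hf_int, ?_⟩
      rw [integral_sub (hfh.const_mul 2) hf_int, integral_const_mul]
      have hle_mul := const_mul_integral_le_integral_mul_of_le_condExp hX.comap_le hf
        (fun ω => le_max_right _ _) hf_int
        (Integrable.of_bound hind.aestronglyMeasurable 1 hbound) hfh hc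
      linarith
    have hmeas₀ : Measurable (fun ω => g (X ω) β₀) := (hg_meas β₀).comp hX
    obtain ⟨hI₁, hn₁⟩ := hweight β β₀ {ω | Y ω ≤ g (X ω) β₀} (measurableSet_le hY hmeas₀) hle
    obtain ⟨hI₂, hn₂⟩ := hweight β₀ β {ω | g (X ω) β₀ ≤ Y ω} (measurableSet_le hmeas₀ hY) hge
    have hA : ∀ β, Integrable (fun ω => |Y ω - g (X ω) β|) μ := fun β =>
      (hY_int.sub (hgi β)).abs
    have hmono := integral_mono ((hA β₀).add (hI₁.add hI₂)) (hA β)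
      fun ω => abs_sub_add_le_abs_sub (Y ω) (g (X ω) β₀) (g (X ω) β)
    rw [integral_add' (hA β₀) (hI₁.add hI₂), integral_add' hI₁ hI₂] at hmono
    linarith
  refine ⟨hmin, fun βstar hstar => ?_⟩
  by_contra hne
  exact (hstar β₀ (Ne.symm hne)).not_ge (hmin βstar)
end

section
/- Let (X, Y) be a random vector with values in 𝒳 × ℝ, and let g : 𝒳 × ℝ^d → ℝ be measurable with β ↦ g(x, β) differentiable for each x. Suppose there is a neighborhood U of β* ∈ ℝ^d and an integrable random variable G(X) such that |g(X, β) − g(X, β')| ≤ G(X)·‖β − β'‖ for all β, β' ∈ U almost surely, that E|Y − g(X, β)| < ∞ for β ∈ U, and that P(Y = g(X, β*)) = 0. Then F(β) = E|Y − g(X, β)| is differentiable at β* with gradient ∇F(β*) = −E[∇_β g(X, β*) · sign(Y − g(X, β*))]. In particular, if β* is a local minimum of F, then E[∇_β g(X, β*) · sign(Y − g(X, β*))] = 0; that is, the efficient influence function D(p, X, Y) = −∇_β g(X, β(p)) · sign(Y − g(X, β(p))) of the median-regression parameter has mean zero at p. -/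
open MeasureTheory Real

open Filter Topology

theorem Real.measurable_sign : Measurable Real.sign := by
  unfold Real.sign
  exact Measurable.ite measurableSet_Iio measurable_const
    (Measurable.ite measurableSet_Ioi measurable_const measurable_const)

theorem hasDerivAt_abs_real_sign {x : ℝ} (hx : x ≠ 0) : HasDerivAt (|·|) (Real.sign x) x := by
  rcases lt_or_gt_of_ne hx with h | h
  · rw [Real.sign_of_neg h]
    exact hasDerivAt_abs_neg h
  · rw [Real.sign_of_pos h]
    exact hasDerivAt_abs_pos h

theorem HasGradientAt.abs_const_sub {E : Type*} [NormedAddCommGroup E] [InnerProductSpace ℝ E]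
    [CompleteSpace E] {f : E → ℝ} {f' x : E} (hf : HasGradientAt f f' x) {y : ℝ} (hy : y ≠ f x) :
    HasGradientAt (fun z => |y - f z|) (-(Real.sign (y - f x) • f')) x := by
  rw [hasGradientAt_iff_hasFDerivAt] at hf ⊢
  have h := (hasDerivAt_abs_real_sign (sub_ne_zero.2 hy)).comp_hasFDerivAt x (hf.const_sub y)
  refine h.congr_fderiv ?_
  simp

/-- The directional derivatives of a measurable family of differentiable functions are
measurable in the parameter. -/
theorem measurable_fderiv_apply_of_differentiableAt {α E : Type*} [MeasurableSpace α]
    [NormedAddCommGroup E] [NormedSpace ℝ E] {f : α → E → ℝ}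
    (hf : ∀ z, Measurable fun a => f a z) {x : E} (hdiff : ∀ a, DifferentiableAt ℝ (f a) x)
    (v : E) : Measurable fun a => fderiv ℝ (f a) x v := by
  refine measurable_of_tendsto_metrizable
    (f := fun (n : ℕ) a => (n : ℝ) • (f a (x + (n : ℝ)⁻¹ • v) - f a x))
    (fun n => ((hf _).sub (hf _)).const_smul (n : ℝ)) ?_
  refine tendsto_pi_nhds.2 fun a => ?_
  have hc : Tendsto (fun n : ℕ => ‖(n : ℝ)‖) atTop atTop := by
    simpa using tendsto_natCast_atTop_atTop (R := ℝ)
  exact (hdiff a).hasFDerivAt.lim v hc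

theorem measurable_gradient_of_differentiableAt {α ι : Type*} [MeasurableSpace α] [Fintype ι]
    {f : α → EuclideanSpace ℝ ι → ℝ} (hf : ∀ z, Measurable fun a => f a z)
    {x : EuclideanSpace ℝ ι} (hdiff : ∀ a, DifferentiableAt ℝ (f a) x) :
    Measurable fun a => gradient (f a) x := by
  classical
  refine (MeasurableEquiv.toLp 2 (ι → ℝ)).symm.measurableEmbedding.measurable_comp_iff.1 ?_
  refine measurable_pi_iff.2 fun i => ?_
  convert measurable_fderiv_apply_of_differentiableAt hf hdiff (EuclideanSpace.single i 1)
    using 2 with a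
  rw [← InnerProductSpace.toDual_symm_apply, EuclideanSpace.inner_single_right]
  simp [gradient]

/-- Differentiation under the integral sign, in terms of gradients. -/
theorem hasGradientAt_integral_of_dominated_loc_of_lip {α E : Type*} [MeasurableSpace α]
    {μ : Measure α} [NormedAddCommGroup E] [InnerProductSpace ℝ E] [CompleteSpace E]
    {F : E → α → ℝ} {F' : α → E} {bound : α → ℝ} {s : Set E} {x₀ : E} (hs : s ∈ 𝓝 x₀)
    (hF_meas : ∀ x ∈ s, AEStronglyMeasurable (F x) μ) (hF_int : Integrable (F x₀) μ)
    (hF'_meas : AEStronglyMeasurable F' μ)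
    (h_lip : ∀ᵐ a ∂μ, ∀ x ∈ s, ‖F x a - F x₀ a‖ ≤ bound a * ‖x - x₀‖)
    (bound_integrable : Integrable bound μ)
    (h_diff : ∀ᵐ a ∂μ, HasGradientAt (F · a) (F' a) x₀) :
    HasGradientAt (fun x => ∫ a, F x a ∂μ) (∫ a, F' a ∂μ) x₀ := by
  obtain ⟨hint, hderiv⟩ := hasFDerivAt_integral_of_dominated_loc_of_lip' hs hF_meas hF_int
    ((InnerProductSpace.toDual ℝ E).continuous.comp_aestronglyMeasurable hF'_meas) h_lip
    bound_integrable (h_diff.mono fun a ha => ha.hasFDerivAt)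
  have hF' : Integrable F' μ := hint.congr'_enorm hF'_meas (by simp)
  rw [hasGradientAt_iff_hasFDerivAt]
  refine hderiv.congr_fderiv ?_
  ext v
  rw [ContinuousLinearMap.integral_apply hint, InnerProductSpace.toDual_apply_apply,
    real_inner_comm, ← integral_inner hF']
  simp [real_inner_comm]

/-- Under a local Lipschitz domination condition and `P(Y = g(X, β*)) = 0`, the criterion
`F(β) = E|Y − g(X, β)|` is differentiable at `β*` with gradient
`∇F(β*) = −E[∇_β g(X, β*) · sign(Y − g(X, β*))]`; in particular, if `β*` is a local minimum
of `F` then the efficient influence function `−∇_β g(X, β*) sign(Y − g(X, β*))` of the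
median-regression parameter has mean zero. -/
theorem gradient_of_expected_abs_deviation
    {Ω 𝒳 : Type*} [mΩ : MeasurableSpace Ω] [MeasurableSpace 𝒳] {d : ℕ}
    {μ : Measure Ω} [IsProbabilityMeasure μ]
    (X : Ω → 𝒳) (hX : Measurable X)
    (Y : Ω → ℝ) (hY : Measurable Y)
    (g : 𝒳 → EuclideanSpace ℝ (Fin d) → ℝ)
    (hg_meas : ∀ β, Measurable (fun x => g x β))
    (hg_diff : ∀ x, Differentiable ℝ (g x))
    (βstar : EuclideanSpace ℝ (Fin d))
    (U : Set (EuclideanSpace ℝ (Fin d))) (hU : U ∈ nhds βstar)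
    (G : 𝒳 → ℝ) (hG_int : Integrable (fun ω => G (X ω)) μ)
    (hLip : ∀ᵐ ω ∂μ, ∀ β ∈ U, ∀ β' ∈ U,
      |g (X ω) β - g (X ω) β'| ≤ G (X ω) * ‖β - β'‖)
    (hint : ∀ β ∈ U, Integrable (fun ω => |Y ω - g (X ω) β|) μ)
    (hzero : μ {ω | Y ω = g (X ω) βstar} = 0) :
    HasGradientAt (fun β => ∫ ω, |Y ω - g (X ω) β| ∂μ)
      (-∫ ω, Real.sign (Y ω - g (X ω) βstar) • gradient (g (X ω)) βstar ∂μ) βstar ∧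
    (IsLocalMin (fun β => ∫ ω, |Y ω - g (X ω) β| ∂μ) βstar →
      ∫ ω, Real.sign (Y ω - g (X ω) βstar) • gradient (g (X ω)) βstar ∂μ = 0) := by
  have hU₀ : βstar ∈ U := mem_of_mem_nhds hU
  have hgrad : HasGradientAt (fun β => ∫ ω, |Y ω - g (X ω) β| ∂μ)
      (-∫ ω, Real.sign (Y ω - g (X ω) βstar) • gradient (g (X ω)) βstar ∂μ) βstar := by
    rw [← integral_neg]
    refine hasGradientAt_integral_of_dominated_loc_of_lip hU
      (fun β hβ => (hint β hβ).aestronglyMeasurable) (hint βstar hU₀) ?_ ?_ hG_int ?_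
    · have hsign := Real.measurable_sign.comp (hY.sub ((hg_meas βstar).comp hX))
      have hgm := (measurable_gradient_of_differentiableAt hg_meas
        fun x => hg_diff x βstar).comp hX
      exact (hsign.smul hgm).neg.aestronglyMeasurable
    · filter_upwards [hLip] with ω hω β hβ
      refine (abs_abs_sub_abs_le_abs_sub _ _).trans ?_
      rw [sub_sub_sub_cancel_left, abs_sub_comm]
      exact hω β hβ βstar hU₀
    · have hne : ∀ᵐ ω ∂μ, Y ω ≠ g (X ω) βstar := measure_eq_zero_iff_ae_notMem.1 hzero
      filter_upwards [hne] with ω hω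
      exact (hg_diff (X ω) βstar).hasGradientAt.abs_const_sub hω
  refine ⟨hgrad, fun hmin => ?_⟩
  have h := hmin.hasFDerivAt_eq_zero hgrad.hasFDerivAt
  simpa using h
end

section
/- Let (W, A, Y) be random variables on a probability space, with W taking values in a measurable space 𝒲, A real-valued, and Y bounded real-valued. Let ρ : ℝ × 𝒲 → [0, ∞) be measurable with ρ(a, w) > 0 for all (a, w), and suppose ρ is a conditional density of A given W with respect to Lebesgue measure, i.e., for every bounded measurable f : ℝ × 𝒲 → ℝ, E[f(A, W)] = E[∫_ℝ f(a, W) ρ(a, W) da]. Let μ : ℝ × 𝒲 → ℝ be bounded measurable with E[Y | σ(A, W)] = μ(A, W) a.s., assume E[ρ(A − γ, W)/ρ(A, W)] < ∞, and set Ψ = E[μ(A + γ, W)]. Then E[ (ρ(A − γ, W)/ρ(A, W))·(Y − μ(A, W)) + μ(A + γ, W) − Ψ ] = 0; that is, the efficient influence function of the shifted-exposure parameter has mean zero. -/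
open MeasureTheory Real

/-- The efficient influence function of the shifted-exposure parameter
`Ψ = E[μ(A + γ, W)]`, namely
`D(p,O) = (ρ(A − γ, W)/ρ(A, W))(Y − μ(A, W)) + μ(A + γ, W) − Ψ`, has mean zero. Here `ρ` is
a strictly positive conditional density of `A` given `W` with respect to Lebesgue measure and
`μfn` is a bounded version of the outcome regression `E[Y | A, W]`. -/
theorem eif_shifted_exposure_mean_zero
    {Ω 𝒲 : Type*} [mΩ : MeasurableSpace Ω] [MeasurableSpace 𝒲]
    {μ : Measure Ω} [IsProbabilityMeasure μ]
    (W : Ω → 𝒲) (hW : Measurable W)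
    (A : Ω → ℝ) (hA : Measurable A)
    (Y : Ω → ℝ) (hY : Measurable Y) (hYbdd : ∃ CY : ℝ, ∀ ω, |Y ω| ≤ CY)
    (ρ : ℝ → 𝒲 → ℝ) (hρ_meas : Measurable (fun q : ℝ × 𝒲 => ρ q.1 q.2))
    (hρ_pos : ∀ a w, 0 < ρ a w)
    (hρ_dens : ∀ f : ℝ → 𝒲 → ℝ, Measurable (fun q : ℝ × 𝒲 => f q.1 q.2) →
      (∃ Cf : ℝ, ∀ a w, |f a w| ≤ Cf) →
      ∫ ω, f (A ω) (W ω) ∂μ = ∫ ω, (∫ a : ℝ, f a (W ω) * ρ a (W ω)) ∂μ)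
    (μfn : ℝ → 𝒲 → ℝ) (hμfn_meas : Measurable (fun q : ℝ × 𝒲 => μfn q.1 q.2))
    (hμfn_bdd : ∃ Cμ : ℝ, ∀ a w, |μfn a w| ≤ Cμ)
    (hμfn_reg : μ[Y|MeasurableSpace.comap (fun ω => (A ω, W ω)) inferInstance]
      =ᵐ[μ] fun ω => μfn (A ω) (W ω))
    (γ : ℝ)
    (hweight_int : Integrable (fun ω => ρ (A ω - γ) (W ω) / ρ (A ω) (W ω)) μ)
    (Ψ : ℝ) (hΨ : Ψ = ∫ ω, μfn (A ω + γ) (W ω) ∂μ) :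
    ∫ ω, (ρ (A ω - γ) (W ω) / ρ (A ω) (W ω)) * (Y ω - μfn (A ω) (W ω))
        + μfn (A ω + γ) (W ω) - Ψ ∂μ = 0 := by
  obtain ⟨CY, hCY⟩ := hYbdd
  obtain ⟨Cμ, hCμ⟩ := hμfn_bdd
  have hAW : Measurable (fun ω => (A ω, W ω)) := hA.prodMk hW
  have hm := hAW.comap_le
  have hw_meas : Measurable (fun q : ℝ × 𝒲 => ρ (q.1 - γ) q.2 / ρ q.1 q.2) :=
    (hρ_meas.comp ((measurable_fst.sub_const γ).prodMk measurable_snd)).div hρ_meas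
  have hY_int : Integrable Y μ :=
    .of_bound hY.aestronglyMeasurable CY (.of_forall hCY)
  have hwY : Integrable (fun ω => (ρ (A ω - γ) (W ω) / ρ (A ω) (W ω)) * Y ω) μ :=
    hweight_int.mul_bdd hY.aestronglyMeasurable (.of_forall hCY)
  have hwμ : Integrable
      (fun ω => (ρ (A ω - γ) (W ω) / ρ (A ω) (W ω)) * μfn (A ω) (W ω)) μ :=
    hweight_int.mul_bdd (hμfn_meas.comp hAW).aestronglyMeasurable
      (.of_forall fun ω => hCμ (A ω) (W ω))
  have hshift : Integrable (fun ω => μfn (A ω + γ) (W ω)) μ :=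
    .of_bound (hμfn_meas.comp ((hA.add_const γ).prodMk hW)).aestronglyMeasurable Cμ
      (.of_forall fun ω => hCμ (A ω + γ) (W ω))
  have hpull := condExp_mul_of_stronglyMeasurable_left
    (hw_meas.comp (comap_measurable (fun ω => (A ω, W ω)))).stronglyMeasurable hwY hY_int
  have hresidual : ∫ ω, (ρ (A ω - γ) (W ω) / ρ (A ω) (W ω)) * Y ω ∂μ
      = ∫ ω, (ρ (A ω - γ) (W ω) / ρ (A ω) (W ω)) * μfn (A ω) (W ω) ∂μ := by
    rw [← integral_condExp hm]
    refine integral_congr_ae ?_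
    filter_upwards [hpull, hμfn_reg] with ω h₁ h₂
    exact h₁.trans (congrArg (_ * ·) h₂)
  simp only [mul_sub]
  rw [integral_sub (by exact (hwY.sub hwμ).add hshift) (integrable_const Ψ),
    integral_add (by exact hwY.sub hwμ) hshift, integral_sub hwY hwμ, hresidual, ← hΨ]
  simp
end

section
/- Let (W, A) be random variables on a probability space, with W taking values in a measurable space 𝒲 and A real-valued. Let ρ : ℝ × 𝒲 → [0, ∞) be measurable with ρ(a, w) > 0 for all (a, w), and suppose ρ is a conditional density of A given W with respect to Lebesgue measure, i.e., for every bounded measurable f : ℝ × 𝒲 → ℝ, E[f(A, W)] = E[∫_ℝ f(a, W) ρ(a, W) da]. Then for every bounded measurable μ : ℝ × 𝒲 → ℝ and every γ ∈ ℝ with E[ρ(A − γ, W)/ρ(A, W)] < ∞, E[μ(A + γ, W)] = E[ (ρ(A − γ, W)/ρ(A, W)) · μ(A, W) ]; that is, the shifted-exposure parameter admits the inverse-probability-weighted representation with weight ρ(A − γ, W)/ρ(A, W). -/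
open MeasureTheory Real

/-- A positive conditional density of `A` given `W`, characterised by expectations of bounded
measurable functions, is a density of the joint law of `(A, W)` with respect to the product of
Lebesgue measure and the law of `W`. -/
theorem map_prodMk_eq_withDensity_of_integral_eq
    {Ω 𝒲 : Type*} [MeasurableSpace Ω] [MeasurableSpace 𝒲]
    {μ : Measure Ω} [IsProbabilityMeasure μ]
    {W : Ω → 𝒲} (hW : Measurable W) {A : Ω → ℝ} (hA : Measurable A)
    {ρ : ℝ → 𝒲 → ℝ} (hρ_meas : Measurable (fun q : ℝ × 𝒲 => ρ q.1 q.2))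
    (hρ_nonneg : ∀ a w, 0 ≤ ρ a w)
    (hρ_dens : ∀ f : ℝ → 𝒲 → ℝ, Measurable (fun q : ℝ × 𝒲 => f q.1 q.2) →
      (∃ Cf : ℝ, ∀ a w, |f a w| ≤ Cf) →
      ∫ ω, f (A ω) (W ω) ∂μ = ∫ ω, (∫ a : ℝ, f a (W ω) * ρ a (W ω)) ∂μ) :
    μ.map (fun ω => (A ω, W ω)) =
      ((volume : Measure ℝ).prod (μ.map W)).withDensity
        (fun q => ENNReal.ofReal (ρ q.1 q.2)) := by
  have hT : Measurable (fun ω => (A ω, W ω)) := hA.prodMk hW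
  let G : Set (ℝ × 𝒲) → 𝒲 → ENNReal := fun S w =>
    ∫⁻ a, S.indicator (fun q => ENNReal.ofReal (ρ q.1 q.2)) (a, w)
  have hG_meas : ∀ S, MeasurableSet S → Measurable (G S) := fun S hS =>
    (hρ_meas.ennreal_ofReal.indicator hS).lintegral_prod_left'
  have hG_mono : ∀ S w, G S w ≤ G Set.univ w := fun S w =>
    lintegral_mono fun a => Set.indicator_le_indicator_of_subset (Set.subset_univ S)
      (fun _ => zero_le) _
  have key : ∀ S, MeasurableSet S →
      μ.real ((fun ω => (A ω, W ω)) ⁻¹' S) = ∫ ω, (G S (W ω)).toReal ∂μ := by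
    intro S hS
    have hf : Measurable (S.indicator (fun _ => (1 : ℝ))) := measurable_const.indicator hS
    have h := hρ_dens (fun a w => S.indicator (fun _ => (1 : ℝ)) (a, w)) hf
      ⟨1, fun a w => by by_cases h : (a, w) ∈ S <;> simp [h]⟩
    rw [← integral_indicator_one (hT hS)]
    refine h.trans (integral_congr_ae (Filter.Eventually.of_forall fun ω => ?_))
    dsimp only [G]
    rw [integral_eq_lintegral_of_nonneg_ae]
    · congr 1
      refine lintegral_congr fun a => ?_
      by_cases h : (a, W ω) ∈ S <;> simp [h]
    · refine Filter.Eventually.of_forall fun a => ?_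
      by_cases h : (a, W ω) ∈ S <;> simp [h, hρ_nonneg]
    · exact ((hf.mul hρ_meas).comp measurable_prodMk_right).aestronglyMeasurable
  have hfin : ∀ᵐ ω ∂μ, G Set.univ (W ω) < ⊤ := by
    have hN : MeasurableSet {w | G Set.univ w = ⊤} :=
      hG_meas _ MeasurableSet.univ (measurableSet_singleton ⊤)
    have h := key (Prod.snd ⁻¹' {w | G Set.univ w = ⊤}) (measurable_snd hN)
    have h0 : ∀ w, (G (Prod.snd ⁻¹' {w | G Set.univ w = ⊤}) w).toReal = 0 := by
      intro w
      by_cases hw : G Set.univ w = ⊤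
      · have : G (Prod.snd ⁻¹' {w | G Set.univ w = ⊤}) w = G Set.univ w :=
          lintegral_congr fun a => by
            rw [Set.indicator_of_mem (by exact hw), Set.indicator_of_mem (Set.mem_univ _)]
        rw [this, hw, ENNReal.toReal_top]
      · have : G (Prod.snd ⁻¹' {w | G Set.univ w = ⊤}) w = ∫⁻ _ : ℝ, 0 :=
          lintegral_congr fun a => Set.indicator_of_notMem (by exact hw) _
        rw [this, lintegral_zero, ENNReal.toReal_zero]
    simp only [h0, integral_zero] at h
    rw [measureReal_eq_zero_iff] at h
    rw [ae_iff]
    simp only [not_lt, top_le_iff]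
    exact h
  have key' : ∀ S, MeasurableSet S →
      μ.real ((fun ω => (A ω, W ω)) ⁻¹' S) = (∫⁻ ω, G S (W ω) ∂μ).toReal := by
    intro S hS
    rw [key S hS]
    refine integral_toReal ((hG_meas S hS).comp hW).aemeasurable ?_
    filter_upwards [hfin] with ω hω using (hG_mono S _).trans_lt hω
  have htop : ∫⁻ ω, G Set.univ (W ω) ∂μ ≠ ⊤ := by
    intro h
    have := key' Set.univ MeasurableSet.univ
    simp [h] at this
  ext S hS
  rw [Measure.map_apply hT hS, withDensity_apply _ hS, ← lintegral_indicator hS,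
    lintegral_prod_symm _ (hρ_meas.ennreal_ofReal.indicator hS).aemeasurable,
    lintegral_map (hG_meas S hS) hW]
  exact (ENNReal.toReal_eq_toReal_iff' (measure_ne_top _ _)
    (ne_top_of_le_ne_top htop (lintegral_mono fun ω => hG_mono S _))).1 (key' S hS)

/-- The shifted-exposure parameter admits an inverse-probability-weighted representation:
if `ρ` is a strictly positive conditional density of `A` given `W` with respect to Lebesgue
measure, then for every bounded measurable `μfn` and every shift `γ` with integrable weight
`ρ(A − γ, W)/ρ(A, W)`, one has
`E[μfn(A + γ, W)] = E[(ρ(A − γ, W)/ρ(A, W)) · μfn(A, W)]`. -/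
theorem shifted_exposure_ipw_representation
    {Ω 𝒲 : Type*} [mΩ : MeasurableSpace Ω] [MeasurableSpace 𝒲]
    {μ : Measure Ω} [IsProbabilityMeasure μ]
    (W : Ω → 𝒲) (hW : Measurable W)
    (A : Ω → ℝ) (hA : Measurable A)
    (ρ : ℝ → 𝒲 → ℝ) (hρ_meas : Measurable (fun q : ℝ × 𝒲 => ρ q.1 q.2))
    (hρ_pos : ∀ a w, 0 < ρ a w)
    (hρ_dens : ∀ f : ℝ → 𝒲 → ℝ, Measurable (fun q : ℝ × 𝒲 => f q.1 q.2) →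
      (∃ Cf : ℝ, ∀ a w, |f a w| ≤ Cf) →
      ∫ ω, f (A ω) (W ω) ∂μ = ∫ ω, (∫ a : ℝ, f a (W ω) * ρ a (W ω)) ∂μ) :
    ∀ μfn : ℝ → 𝒲 → ℝ, Measurable (fun q : ℝ × 𝒲 => μfn q.1 q.2) →
      (∃ Cμ : ℝ, ∀ a w, |μfn a w| ≤ Cμ) →
      ∀ γ : ℝ, Integrable (fun ω => ρ (A ω - γ) (W ω) / ρ (A ω) (W ω)) μ →
      ∫ ω, μfn (A ω + γ) (W ω) ∂μ
        = ∫ ω, (ρ (A ω - γ) (W ω) / ρ (A ω) (W ω)) * μfn (A ω) (W ω) ∂μ := by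
  intro m hm _ γ _
  have hT : Measurable (fun ω => (A ω, W ω)) := hA.prodMk hW
  have hmap := map_prodMk_eq_withDensity_of_integral_eq hW hA hρ_meas
    (fun a w => (hρ_pos a w).le) hρ_dens
  have integral_eq : ∀ f : ℝ × 𝒲 → ℝ, Measurable f →
      ∫ ω, f (A ω, W ω) ∂μ = ∫ q, ρ q.1 q.2 * f q ∂((volume : Measure ℝ).prod (μ.map W)) := by
    intro f hf
    rw [← integral_map hT.aemeasurable hf.aestronglyMeasurable, hmap,
      integral_withDensity_eq_integral_toReal_smul hρ_meas.ennreal_ofReal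
        (Filter.Eventually.of_forall fun _ => ENNReal.ofReal_lt_top)]
    simp only [ENNReal.toReal_ofReal (hρ_pos _ _).le, smul_eq_mul]
  have hadd : Measurable (fun q : ℝ × 𝒲 => (q.1 + γ, q.2)) := by fun_prop
  have hsub : Measurable (fun q : ℝ × 𝒲 => (q.1 - γ, q.2)) := by fun_prop
  have hρ_sub : Measurable (fun q : ℝ × 𝒲 => ρ (q.1 - γ) q.2) := hρ_meas.comp hsub
  have hshift : MeasurePreserving (fun q : ℝ × 𝒲 => (q.1 + γ, q.2))
      ((volume : Measure ℝ).prod (μ.map W)) ((volume : Measure ℝ).prod (μ.map W)) :=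
    (measurePreserving_add_right volume γ).prod (MeasurePreserving.id _)
  rw [integral_eq (fun q => m (q.1 + γ) q.2) (hm.comp hadd),
    integral_eq (fun q => ρ (q.1 - γ) q.2 / ρ q.1 q.2 * m q.1 q.2) ((hρ_sub.div hρ_meas).mul hm)]
  calc ∫ q, ρ q.1 q.2 * m (q.1 + γ) q.2 ∂((volume : Measure ℝ).prod (μ.map W))
      = ∫ q, ρ (q.1 - γ) q.2 * m q.1 q.2 ∂((volume : Measure ℝ).prod (μ.map W)) := by
        conv_rhs => rw [← hshift.map_eq]
        have hprod : Measurable (fun q : ℝ × 𝒲 => ρ (q.1 - γ) q.2 * m q.1 q.2) := hρ_sub.mul hm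
        rw [integral_map hadd.aemeasurable hprod.aestronglyMeasurable]
        simp only [add_sub_cancel_right]
    _ = _ := by
        refine integral_congr_ae (Filter.Eventually.of_forall fun q => ?_)
        have := (hρ_pos q.1 q.2).ne'
        dsimp only
        field_simp
end

section
/- Let S be a type, n ≥ 1, and x₁, …, x_n ∈ S a sample. For s ∈ S let c(s) = #{i : x_i = s} denote the empirical count. Then for every function q : S → [0, ∞) with Σ_{s ∈ {x₁,…,x_n}} q(s) ≤ 1, the likelihood satisfies ∏_{i=1}^n q(x_i) ≤ ∏_{i=1}^n (c(x_i)/n); that is, the empirical distribution, which places mass c(s)/n on each observed value s, maximizes the likelihood over all probability distributions, and hence is the maximum likelihood estimator of the marginal distribution in the nonparametric model. -/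
/-- Nonnegative reals with average at most one have product at most one. -/
theorem Finset.prod_le_one_of_sum_le_card {ι : Type*} (s : Finset ι) (z : ι → ℝ)
    (hz : ∀ i ∈ s, 0 ≤ z i) (hsum : ∑ i ∈ s, z i ≤ s.card) : ∏ i ∈ s, z i ≤ 1 := by
  calc ∏ i ∈ s, z i ≤ ∏ i ∈ s, Real.exp (z i - 1) :=
        Finset.prod_le_prod hz fun i _ => by linarith [Real.add_one_le_exp (z i - 1)]
    _ = Real.exp (∑ i ∈ s, (z i - 1)) := (Real.exp_sum s _).symm
    _ ≤ 1 := by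
        rw [Real.exp_le_one_iff, Finset.sum_sub_distrib]
        simpa using hsum

/-- The empirical distribution is the nonparametric maximum likelihood estimator of the
marginal distribution: for a sample `x₁, …, x_n`, with empirical counts
`c(s) = #{i : xᵢ = s}`, every subprobability mass function `q` on the observed values
satisfies `∏ᵢ q(xᵢ) ≤ ∏ᵢ (c(xᵢ)/n)`. -/
theorem empirical_distribution_is_nonparametric_mle
    {S : Type*} [DecidableEq S] (n : ℕ) (hn : 1 ≤ n) (x : Fin n → S)
    (c : S → ℕ) (hc : ∀ s, c s = (Finset.univ.filter (fun i => x i = s)).card)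
    (q : S → ℝ) (hq_nonneg : ∀ s, 0 ≤ q s)
    (hq_sum : ∑ s ∈ Finset.univ.image x, q s ≤ 1) :
    ∏ i, q (x i) ≤ ∏ i, ((c (x i) : ℝ) / n) := by
  have hn' : (0 : ℝ) < n := by exact_mod_cast hn
  have hc_pos : ∀ i, (0 : ℝ) < c (x i) := fun i => by
    rw [hc]
    exact_mod_cast Finset.card_pos.mpr ⟨i, by simp⟩
  have hw : ∀ i, 0 < (c (x i) : ℝ) / n := fun i => div_pos (hc_pos i) hn'
  have hsum : ∑ i, q (x i) / ((c (x i) : ℝ) / n) = n * ∑ s ∈ Finset.univ.image x, q s := by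
    rw [Finset.sum_comp (fun s => q s / ((c s : ℝ) / n)) x, Finset.mul_sum]
    refine Finset.sum_congr rfl fun s hs => ?_
    obtain ⟨i, -, rfl⟩ := Finset.mem_image.mp hs
    rw [← hc, nsmul_eq_mul]
    have := (hc_pos i).ne'
    field_simp
  have h := Finset.univ.prod_le_one_of_sum_le_card (fun i => q (x i) / ((c (x i) : ℝ) / n))
    (fun i _ => div_nonneg (hq_nonneg _) (hw i).le) (by
      rw [hsum, Finset.card_univ, Fintype.card_fin]
      exact mul_le_of_le_one_right hn'.le hq_sum)
  rwa [Finset.prod_div_distrib, div_le_one (Finset.prod_pos fun i _ => hw i)] at h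
end
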